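/- The set of families (w_k)_{k ∈ ℤ/7ℤ} of elements of Λ³ℂ⁷ satisfying, for all k ∈ ℤ/7ℤ, the equivariance conditions (Λ³σ)(w_k) = w_{k−1}, (Λ³τ)(w_k) = ε^{3k} w_k, and (Λ³ι)(w_k) = w_{−k}, is a ℂ-vector subspace of dimension exactly 4 of (Λ³ℂ⁷)^{ℤ/7ℤ}, with basis given by the four families (u₀(k))_k, (u₁(k))_k, (u₂(k))_k, (u₃(k))_k. -/

import Mathlib

noncomputable section

/-- `ε = exp(2πi/7)`. -/
noncomputable def ε : ℂ := Complex.exp (2 * Real.pi * Complex.I / 7)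

/-- `σ` as a linear map on ℂ⁷: `σ(e_j) = e_{j-1}`. -/
noncomputable def σ : (ZMod 7 → ℂ) →ₗ[ℂ] (ZMod 7 → ℂ) :=
  Matrix.toLin' (Matrix.of fun i j : ZMod 7 => if j = i + 1 then (1 : ℂ) else 0)

/-- `τ` as a linear map on ℂ⁷: `τ(e_j) = ε^j e_j`. -/
noncomputable def τ : (ZMod 7 → ℂ) →ₗ[ℂ] (ZMod 7 → ℂ) :=
  Matrix.toLin' (Matrix.of fun i j : ZMod 7 => if i = j then ε ^ j.val else 0)

/-- `ι` as a linear map on ℂ⁷: `ι(e_j) = -e_{-j}`. -/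
noncomputable def ιinv : (ZMod 7 → ℂ) →ₗ[ℂ] (ZMod 7 → ℂ) :=
  Matrix.toLin' (Matrix.of fun i j : ZMod 7 => if i = -j then (-1 : ℂ) else 0)

/-- The image in the exterior algebra of the standard basis vector `e_j` of ℂ⁷. -/
noncomputable def e (j : ZMod 7) : ExteriorAlgebra ℂ (ZMod 7 → ℂ) :=
  ExteriorAlgebra.ι ℂ (Pi.single j 1)

/-- The family u₀: k ↦ e_{1+k}∧e_{4+k}∧e_{2+k} − e_{6+k}∧e_{3+k}∧e_{5+k}. -/
noncomputable def u₀ : ZMod 7 → ExteriorAlgebra ℂ (ZMod 7 → ℂ) := fun k =>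
  e (1 + k) * e (4 + k) * e (2 + k) - e (6 + k) * e (3 + k) * e (5 + k)

/-- The family u₁: k ↦ e_k∧e_{1+k}∧e_{6+k}. -/
noncomputable def u₁ : ZMod 7 → ExteriorAlgebra ℂ (ZMod 7 → ℂ) := fun k =>
  e k * e (1 + k) * e (6 + k)

/-- The family u₂: k ↦ e_k∧e_{2+k}∧e_{5+k}. -/
noncomputable def u₂ : ZMod 7 → ExteriorAlgebra ℂ (ZMod 7 → ℂ) := fun k =>
  e k * e (2 + k) * e (5 + k)

/-- The family u₃: k ↦ e_k∧e_{4+k}∧e_{3+k}. -/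
noncomputable def u₃ : ZMod 7 → ExteriorAlgebra ℂ (ZMod 7 → ℂ) := fun k =>
  e k * e (4 + k) * e (3 + k)

open ExteriorAlgebra in
lemma e_sq (a : ZMod 7) : e a * e a = 0 := ι_sq_zero _

open ExteriorAlgebra in
lemma e_swap (a b : ZMod 7) : e a * e b = - (e b * e a) :=
  eq_neg_of_add_eq_zero_left (ι_add_mul_swap _ _)

lemma sigma_single (j : ZMod 7) : σ (Pi.single j 1) = Pi.single (j - 1) 1 := by
  ext i
  simp only [σ, Matrix.toLin'_apply, Matrix.mulVec_single_one, Matrix.col_apply, Matrix.of_apply,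
    Pi.single_apply]
  congr 1
  rw [eq_sub_iff_add_eq]
  exact propext eq_comm

lemma tau_single (j : ZMod 7) : τ (Pi.single j 1) = ε ^ j.val • Pi.single j 1 := by
  ext i
  simp [τ, Pi.single_apply]

lemma iota_single (j : ZMod 7) : ιinv (Pi.single j 1) = - Pi.single (-j) 1 := by
  ext i
  simp only [ιinv, Matrix.toLin'_apply, Matrix.mulVec_single_one, Matrix.col_apply,
    Matrix.of_apply, Pi.single_apply, Pi.neg_apply]
  split_ifs <;> simp

lemma sigma_e (j : ZMod 7) : ExteriorAlgebra.map σ (e j) = e (j - 1) := by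
  simp [e, sigma_single]

lemma tau_e (j : ZMod 7) : ExteriorAlgebra.map τ (e j) = ε ^ j.val • e j := by
  simp [e, tau_single]

lemma iota_e (j : ZMod 7) : ExteriorAlgebra.map ιinv (e j) = - e (-j) := by
  simp [e, iota_single]

lemma eps_prim : IsPrimitiveRoot ε 7 := by
  have := Complex.isPrimitiveRoot_exp 7 (by norm_num)
  simpa [ε] using this

lemma eps_pow_eq {m n : ℕ} (h : (m : ZMod 7) = n) : ε ^ m = ε ^ n := by
  rw [ZMod.natCast_eq_natCast_iff] at h
  have hr : ∀ n : ℕ, ε ^ n = ε ^ (n % 7) := fun n => by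
    conv_lhs => rw [← Nat.div_add_mod n 7, pow_add, pow_mul, eps_prim.pow_eq_one, one_pow, one_mul]
  rw [hr m, hr n, h]

lemma tau_eee (a b c d : ZMod 7) (h : a + b + c = d) :
    ExteriorAlgebra.map τ (e a * e b * e c) = ε ^ d.val • (e a * e b * e c) := by
  simp only [map_mul, tau_e, smul_mul_assoc, mul_smul_comm, smul_smul, ← pow_add]
  congr 1
  apply eps_pow_eq
  simp [← h]
  ring

/-- The submodule of equivariant families. -/
def equivSub : Submodule ℂ (ZMod 7 → ExteriorAlgebra ℂ (ZMod 7 → ℂ)) where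
  carrier := {w | ∀ k : ZMod 7,
          ExteriorAlgebra.map σ (w k) = w (k - 1) ∧
          ExteriorAlgebra.map τ (w k) = ε ^ (3 * k).val • w k ∧
          ExteriorAlgebra.map ιinv (w k) = w (-k)}
  add_mem' := by
    intro a b ha hb k
    obtain ⟨h1, h2, h3⟩ := ha k
    obtain ⟨g1, g2, g3⟩ := hb k
    simp [h1, h2, h3, g1, g2, g3]
  zero_mem' := by intro k; simp
  smul_mem' := by
    intro c a ha k
    obtain ⟨h1, h2, h3⟩ := ha k
    simp [h1, h2, h3, smul_comm c]

lemma u0_mem : u₀ ∈ equivSub := by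
  intro k
  refine ⟨?_, ?_, ?_⟩
  · simp only [u₀, map_sub, map_mul, sigma_e, add_sub_assoc]
  · simp only [u₀, map_sub, smul_sub]
    rw [tau_eee _ _ _ (3 * k) (by decide +revert), tau_eee _ _ _ (3 * k) (by decide +revert)]
  · have h1 : -(1 + k) = 6 + -k := by decide +revert
    have h2 : -(2 + k) = 5 + -k := by decide +revert
    have h3 : -(3 + k) = 4 + -k := by decide +revert
    have h4 : -(4 + k) = 3 + -k := by decide +revert
    have h5 : -(5 + k) = 2 + -k := by decide +revert
    have h6 : -(6 + k) = 1 + -k := by decide +revert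
    simp only [u₀, map_sub, map_mul, iota_e, h1, h2, h3, h4, h5, h6]
    simp only [neg_mul, mul_neg, neg_neg]
    abel

lemma eee_mem (a b : ZMod 7) (hab : a + b = 0) :
    (fun k => e k * e (a + k) * e (b + k)) ∈ equivSub := by
  intro k
  refine ⟨?_, ?_, ?_⟩
  · simp only [map_mul, sigma_e, add_sub_assoc]
  · dsimp only
    rw [tau_eee _ _ _ (3 * k) (by linear_combination hab)]
  · have h1 : -(a + k) = b + -k := by linear_combination - hab
    have h2 : -(b + k) = a + -k := by linear_combination - hab
    simp only [map_mul, iota_e, h1, h2]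
    simp only [neg_mul, mul_neg, neg_neg]
    rw [mul_assoc, e_swap (b + -k)]
    simp [mul_assoc]

lemma u1_mem : u₁ ∈ equivSub := eee_mem 1 6 (by decide)
lemma u2_mem : u₂ ∈ equivSub := eee_mem 2 5 (by decide)
lemma u3_mem : u₃ ∈ equivSub := eee_mem 4 3 (by decide)

abbrev EA := ExteriorAlgebra ℂ (ZMod 7 → ℂ)

/-- Sum of the first seven powers of an endomorphism. -/
def avg (T : EA →ₗ[ℂ] EA) : EA →ₗ[ℂ] EA := ∑ j ∈ Finset.range 7, T ^ j

lemma avg_eig (T : EA →ₗ[ℂ] EA) (x : EA) (z : ℂ) (h : T x = z • x) :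
    avg T x = (∑ j ∈ Finset.range 7, z ^ j) • x := by
  have : ∀ j : ℕ, (T ^ j) x = z ^ j • x := by
    intro j
    induction j with
    | zero => simp
    | succ n ih => rw [pow_succ', Module.End.mul_apply, ih, map_smul, h, smul_smul, pow_succ]
  simp [avg, LinearMap.sum_apply, this, Finset.sum_smul]

lemma avg_fix (T : EA →ₗ[ℂ] EA) (x : EA) (h : T x = x) : avg T x = (7 : ℂ) • x := by
  rw [avg_eig T x 1 (by simpa using h)]; simp

lemma avg_kill (T : EA →ₗ[ℂ] EA) (x : EA) (z : ℂ) (h : T x = z • x) (h1 : z ≠ 1)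
    (h7 : z ^ 7 = 1) : avg T x = 0 := by
  rw [avg_eig T x z h, geom_sum_eq h1, h7]; simp

/-- Degree operator. -/
def T1 : EA →ₗ[ℂ] EA :=
  (ε ^ 4) • (ExteriorAlgebra.map (ε • (LinearMap.id : (ZMod 7 → ℂ) →ₗ[ℂ] _))).toLinearMap

def T2 : EA →ₗ[ℂ] EA := (ExteriorAlgebra.map τ).toLinearMap

def RR : EA →ₗ[ℂ] EA := LinearMap.id + (ExteriorAlgebra.map ιinv).toLinearMap

/-- The span of the values at zero. -/
def S0 : Submodule ℂ EA := Submodule.span ℂ {u₀ 0, u₁ 0, u₂ 0, u₃ 0}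

lemma T1_multi (n : ℕ) (m : Fin n → (ZMod 7 → ℂ)) :
    T1 (ExteriorAlgebra.ιMulti ℂ n m) = ε ^ (n + 4) • ExteriorAlgebra.ιMulti ℂ n m := by
  have : (⇑(ε • (LinearMap.id : (ZMod 7 → ℂ) →ₗ[ℂ] _)) ∘ m) = fun i => ε • m i := by
    ext i; simp
  simp only [T1, LinearMap.smul_apply, AlgHom.toLinearMap_apply, ExteriorAlgebra.map_apply_ιMulti,
    this]
  have := (ExteriorAlgebra.ιMulti ℂ n (M := ZMod 7 → ℂ)).toMultilinearMap.map_smul_univ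
    (fun _ => ε) m
  simp only [AlternatingMap.coe_multilinearMap, Finset.prod_const, Finset.card_univ,
    Fintype.card_fin] at this
  rw [this, smul_smul, ← pow_add, add_comm]

lemma eps_ne (n : ℕ) (h : (n : ZMod 7) ≠ 0) : ε ^ n ≠ 1 := by
  intro h1
  exact h ((ZMod.natCast_eq_zero_iff _ _).2 (eps_prim.dvd_of_pow_eq_one n h1))

lemma eps_pow7 (n : ℕ) : (ε ^ n) ^ 7 = 1 := by
  rw [← pow_mul, mul_comm, pow_mul, eps_prim.pow_eq_one, one_pow]

lemma u0_in : u₀ 0 ∈ S0 := Submodule.subset_span (by simp)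
lemma u1_in : u₁ 0 ∈ S0 := Submodule.subset_span (by simp)
lemma u2_in : u₂ 0 ∈ S0 := Submodule.subset_span (by simp)
lemma u3_in : u₃ 0 ∈ S0 := Submodule.subset_span (by simp)

/-- Statement that the symmetrisation of `e_a e_b e_c` lies in the span. -/
def Good (a b c : ZMod 7) : Prop := RR (e a * e b * e c) ∈ S0

lemma Good.swap1 {a b c : ZMod 7} (h : Good a b c) : Good b a c := by
  unfold Good at *
  rw [e_swap b a, neg_mul, map_neg]
  exact S0.neg_mem h

lemma Good.swap2 {a b c : ZMod 7} (h : Good a b c) : Good a c b := by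
  unfold Good at *
  rw [mul_assoc, e_swap c b, mul_neg, map_neg, ← mul_assoc]
  exact S0.neg_mem h

lemma good_fix {a b c : ZMod 7} {i : ZMod 7 → EA} (hi : i ∈ equivSub) (hm : i 0 ∈ S0)
    (h : e a * e b * e c = i 0) : Good a b c := by
  unfold Good
  rw [h]
  have := (hi 0).2.2
  simp only [RR, LinearMap.add_apply, LinearMap.id_apply, AlgHom.toLinearMap_apply, this, neg_zero]
  exact S0.add_mem hm hm

lemma good_142 : Good 1 4 2 := by
  have : RR (e 1 * e 4 * e 2) = u₀ 0 := by
    have h1 : -(1 : ZMod 7) = 6 := by decide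
    have h2 : -(2 : ZMod 7) = 5 := by decide
    have h4 : -(4 : ZMod 7) = 3 := by decide
    simp [RR, u₀, iota_e, h1, h2, h4, sub_eq_add_neg]
  unfold Good
  rw [this]; exact u0_in

lemma good_635 : Good 6 3 5 := by
  have : RR (e 6 * e 3 * e 5) = - u₀ 0 := by
    have h1 : -(6 : ZMod 7) = 1 := by decide
    have h2 : -(5 : ZMod 7) = 2 := by decide
    have h4 : -(3 : ZMod 7) = 4 := by decide
    simp [RR, u₀, iota_e, h1, h2, h4, sub_eq_add_neg]
  unfold Good
  rw [this]; exact S0.neg_mem u0_in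

lemma good_016 : Good 0 1 6 := good_fix u1_mem u1_in (by simp [u₁])
lemma good_025 : Good 0 2 5 := good_fix u2_mem u2_in (by simp [u₂])
lemma good_043 : Good 0 4 3 := good_fix u3_mem u3_in (by simp [u₃])

/-- All permutations of a triple. -/
def permOf (x y z a b c : ZMod 7) : Prop :=
  (a = x ∧ b = y ∧ c = z) ∨ (a = x ∧ b = z ∧ c = y) ∨ (a = y ∧ b = x ∧ c = z) ∨
  (a = y ∧ b = z ∧ c = x) ∨ (a = z ∧ b = x ∧ c = y) ∨ (a = z ∧ b = y ∧ c = x)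

instance (x y z a b c : ZMod 7) : Decidable (permOf x y z a b c) := by
  unfold permOf; infer_instance

lemma good_perm {x y z a b c : ZMod 7} (h : Good x y z) (hp : permOf x y z a b c) :
    Good a b c := by
  rcases hp with ⟨rfl, rfl, rfl⟩ | ⟨rfl, rfl, rfl⟩ | ⟨rfl, rfl, rfl⟩ | ⟨rfl, rfl, rfl⟩ |
    ⟨rfl, rfl, rfl⟩ | ⟨rfl, rfl, rfl⟩
  · exact h
  · exact h.swap2
  · exact h.swap1
  · exact h.swap1.swap2
  · exact h.swap2.swap1
  · exact h.swap2.swap1.swap2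

lemma triples : ∀ a b : ZMod 7, a ≠ b → a ≠ -a - b → b ≠ -a - b →
    permOf 1 4 2 a b (-a - b) ∨ permOf 6 3 5 a b (-a - b) ∨ permOf 0 1 6 a b (-a - b) ∨
    permOf 0 2 5 a b (-a - b) ∨ permOf 0 4 3 a b (-a - b) := by
  decide

lemma good_all (a b c : ZMod 7) (h : a + b + c = 0) (h1 : a ≠ b) (h2 : a ≠ c) (h3 : b ≠ c) :
    Good a b c := by
  obtain rfl : c = -a - b := by linear_combination h
  rcases triples a b h1 h2 h3 with h | h | h | h | h
  · exact good_perm good_142 h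
  · exact good_perm good_635 h
  · exact good_perm good_016 h
  · exact good_perm good_025 h
  · exact good_perm good_043 h

lemma key (x : EA) : RR (avg T2 (avg T1 x)) ∈ S0 := by
  have hz : S0.mkQ ∘ₗ RR ∘ₗ avg T2 ∘ₗ avg T1 = 0 := by
    apply ExteriorAlgebra.lhom_ext
    intro n
    apply (Pi.basisFun ℂ (ZMod 7)).ext_alternating
    intro v hv
    have hn : n ≤ 7 := by simpa [ZMod.card] using Fintype.card_le_of_injective v hv
    simp only [LinearMap.compAlternatingMap_apply, LinearMap.comp_apply, LinearMap.zero_apply]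
    by_cases h3 : n = 3
    · subst h3
      have hp : (ExteriorAlgebra.ιMulti ℂ 3 fun i => (Pi.basisFun ℂ (ZMod 7)) (v i)) =
          e (v 0) * e (v 1) * e (v 2) := by
        simp only [ExteriorAlgebra.ιMulti_apply, e, mul_assoc, List.ofFn_succ, List.ofFn_zero,
      List.prod_cons, List.prod_nil, mul_one, Pi.basisFun_apply]
        rfl
      rw [avg_fix T1 _ (by rw [T1_multi]; simp [eps_prim.pow_eq_one]), hp]
      by_cases hs : v 0 + v 1 + v 2 = 0
      · rw [map_smul, avg_fix T2 _ (by
          simp only [T2, AlgHom.toLinearMap_apply]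
          rw [tau_eee _ _ _ 0 hs]; simp)]
        simp only [map_smul]
        have : Good (v 0) (v 1) (v 2) := good_all _ _ _ hs (hv.ne (by decide))
          (hv.ne (by decide)) (hv.ne (by decide))
        have h0 : S0.mkQ (RR (e (v 0) * e (v 1) * e (v 2))) = 0 := by
          rw [Submodule.mkQ_apply, Submodule.Quotient.mk_eq_zero]
          exact this
        simp [h0]
      · rw [map_smul, avg_kill T2 _ (ε ^ (v 0 + v 1 + v 2).val) (tau_eee _ _ _ _ rfl)
          (eps_ne _ (by simpa using hs)) (eps_pow7 _)]
        simp
    · rw [avg_kill T1 _ _ (T1_multi _ _) (eps_ne _ _) (eps_pow7 _)]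
      · simp
      · interval_cases n <;> first | exact absurd rfl h3 | decide
  have := LinearMap.congr_fun hz x
  simpa [Submodule.Quotient.mk_eq_zero] using this

lemma T1_fix {w : ZMod 7 → EA} (hw : w ∈ equivSub) : T1 (w 0) = w 0 := by
  have hl : σ ∘ₗ τ = (ε • LinearMap.id) ∘ₗ (τ ∘ₗ σ) := by
    apply (Pi.basisFun ℂ (ZMod 7)).ext
    intro j
    simp only [Pi.basisFun_apply, LinearMap.comp_apply, tau_single, sigma_single, map_smul,
      LinearMap.smul_apply, LinearMap.id_apply, smul_smul, ← pow_succ]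
    congr 1
    apply eps_pow_eq
    simp
  have h := congrArg (fun f => ExteriorAlgebra.map f (w 1)) hl
  simp only [← ExteriorAlgebra.map_comp_map, AlgHom.comp_apply, (hw 1).1, (hw 1).2.1, map_smul,
    sub_self, (hw 0).2.1] at h
  have h' : T1 (w 0) = ε ^ 4 • (ExteriorAlgebra.map (ε • LinearMap.id) (w 0)) := rfl
  rw [h']
  have hv : (3 * (1 : ZMod 7)).val = 3 := by decide
  simp only [mul_zero, ZMod.val_zero, pow_zero, one_smul, hv] at h
  rw [← h, smul_smul, ← pow_add]
  simp [eps_prim.pow_eq_one]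

lemma w0_mem {w : ZMod 7 → EA} (hw : w ∈ equivSub) : w 0 ∈ S0 := by
  have h := key (w 0)
  rw [avg_fix T1 _ (T1_fix hw), map_smul, avg_fix T2 _ (by simpa [T2] using (hw 0).2.1)] at h
  have h3 : RR (w 0) = (2 : ℂ) • w 0 := by
    have := (hw 0).2.2
    simp only [RR, LinearMap.add_apply, LinearMap.id_apply, AlgHom.toLinearMap_apply, this,
      neg_zero, two_smul]
  simp only [map_smul, h3, smul_smul] at h
  exact (S0.smul_mem_iff (by norm_num)).1 h

lemma ext_zero {w : ZMod 7 → EA} (hw : w ∈ equivSub) (h0 : w 0 = 0) : w = 0 := by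
  have : ∀ n : ℕ, w (-(n : ZMod 7)) = 0 := by
    intro n
    induction n with
    | zero => simpa using h0
    | succ n ih =>
      have := (hw (-(n : ZMod 7))).1
      rw [ih, map_zero] at this
      rw [this]
      congr 1
      push_cast
      ring
  funext k
  have := this (-k).val
  simpa using this

lemma equivSub_eq : equivSub = Submodule.span ℂ {u₀, u₁, u₂, u₃} := by
  apply le_antisymm
  · intro w hw
    have h := w0_mem hw
    simp only [S0, Submodule.mem_span_insert, Submodule.mem_span_singleton] at h
    obtain ⟨a, _, ⟨b, _, ⟨c, _, ⟨d, rfl⟩, rfl⟩, rfl⟩, h⟩ := h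
    have hmem : a • u₀ + (b • u₁ + (c • u₂ + d • u₃)) ∈ equivSub :=
      add_mem (equivSub.smul_mem _ u0_mem) (add_mem (equivSub.smul_mem _ u1_mem)
        (add_mem (equivSub.smul_mem _ u2_mem) (equivSub.smul_mem _ u3_mem)))
    have := ext_zero (sub_mem hw hmem) (by simp [h])
    rw [sub_eq_zero.1 this]
    simp only [Submodule.mem_span_insert, Submodule.mem_span_singleton]
    exact ⟨a, _, ⟨b, _, ⟨c, _, ⟨d, rfl⟩, rfl⟩, rfl⟩, rfl⟩
  · rw [Submodule.span_le]
    rintro _ (rfl | rfl | rfl | rfl)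
    exacts [u0_mem, u1_mem, u2_mem, u3_mem]

/-- Coordinate functional attached to a triple of indices. -/
def phi (s : Fin 3 → ZMod 7) : EA →ₗ[ℂ] ℂ :=
  ExteriorAlgebra.liftAlternating (Pi.single 3
    ((Matrix.detRowAlternating (R := ℂ) (n := Fin 3)).compLinearMap (LinearMap.funLeft ℂ ℂ s)))

lemma phi_eee (s : Fin 3 → ZMod 7) (a b c : ZMod 7) : phi s (e a * e b * e c) =
    Matrix.det (Matrix.of fun i j : Fin 3 => if s j = ![a, b, c] i then (1 : ℂ) else 0) := by
  have hp : e a * e b * e c =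
      (ExteriorAlgebra.ιMulti ℂ 3 fun i : Fin 3 => (Pi.single (![a, b, c] i) 1 : ZMod 7 → ℂ)) := by
    simp only [ExteriorAlgebra.ιMulti_apply, e, mul_assoc, List.ofFn_succ, List.ofFn_zero,
      List.prod_cons, List.prod_nil, mul_one, Pi.basisFun_apply]
    rfl
  rw [hp, phi, ExteriorAlgebra.liftAlternating_apply_ιMulti, Pi.single_eq_same,
    AlternatingMap.compLinearMap_apply]
  change Matrix.det _ = Matrix.det _
  congr 1
  ext i j
  simp [LinearMap.funLeft_apply, Pi.single_apply]

lemma lin_indep : LinearIndependent ℂ ![u₀, u₁, u₂, u₃] := by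
  rw [Fintype.linearIndependent_iff]
  intro g hg
  have h := congrFun hg 0
  simp only [Fin.sum_univ_four, Matrix.cons_val, Pi.add_apply, Pi.smul_apply, u₀, u₁, u₂, u₃,
    add_zero, Pi.zero_apply] at h
  have h0 := congrArg (phi ![1, 4, 2]) h
  have h1 := congrArg (phi ![0, 1, 6]) h
  have h2 := congrArg (phi ![0, 2, 5]) h
  have h3 := congrArg (phi ![0, 4, 3]) h
  simp only [map_add, map_smul, map_sub, phi_eee, map_zero, Matrix.det_fin_three, Matrix.of_apply,
    Matrix.cons_val] at h0 h1 h2 h3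
  simp +decide at h0 h1 h2 h3
  intro i
  fin_cases i <;> assumption

/-- the set of families (w_k) in Λ³ℂ⁷ with (Λ³σ)(w_k) = w_{k−1},
(Λ³τ)(w_k) = ε^{3k}·w_k and (Λ³ι)(w_k) = w_{−k} for all k is a ℂ-subspace of
dimension exactly 4, with basis the four families u₀, u₁, u₂, u₃. -/
theorem equivariant_families :
    ({w : ZMod 7 → ExteriorAlgebra ℂ (ZMod 7 → ℂ) |
        ∀ k : ZMod 7,
          ExteriorAlgebra.map σ (w k) = w (k - 1) ∧
          ExteriorAlgebra.map τ (w k) = ε ^ (3 * k).val • w k ∧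
          ExteriorAlgebra.map ιinv (w k) = w (-k)} =
      (Submodule.span ℂ ({u₀, u₁, u₂, u₃} :
          Set (ZMod 7 → ExteriorAlgebra ℂ (ZMod 7 → ℂ))) :
        Set (ZMod 7 → ExteriorAlgebra ℂ (ZMod 7 → ℂ)))) ∧
    LinearIndependent ℂ ![u₀, u₁, u₂, u₃] ∧
    Module.finrank ℂ (Submodule.span ℂ ({u₀, u₁, u₂, u₃} :
      Set (ZMod 7 → ExteriorAlgebra ℂ (ZMod 7 → ℂ)))) = 4 := by
  refine ⟨?_, lin_indep, ?_⟩
  · rw [← equivSub_eq]; rfl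
  · have h := finrank_span_eq_card lin_indep
    have hr : Set.range ![u₀, u₁, u₂, u₃] = {u₀, u₁, u₂, u₃} := by
      simp [Matrix.range_cons, Matrix.range_empty]
      ext x
      simp only [Set.mem_insert_iff, Set.mem_singleton_iff]
      tauto
    rw [hr] at h
    simpa using h

end
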